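/- arXiv:1709.05476 — 8 statements merged into one kernel-verified Lean document; each statement's English description precedes it below -/
import Mathlib

section
/- Under the synchronization FIM setup, assume that for every pair of indices (i,j) the series Δ_{ij} := Σ_{k=1}^∞ [P^k]_{ij} converges. Then: (a) Δ_{ij} ≥ 0 for all i,j; (b) the matrix J is invertible; and (c) the entries of the inverse are given by [J^{-1}]_{ii} = (1 + Δ_{ii})/(c·(d_A(i)+d_R(i)) + ξ(i)) for every i, and [J^{-1}]_{ij} = Δ_{ij}/(c·(d_A(j)+d_R(j)) + ξ(j)) for i ≠ j; equivalently, J^{-1} = (I + Σ_{k=1}^∞ P^k)·D̃^{-1}. -/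
open Matrix Filter Topology

/-- Structure of the inverse FIM (Theorem 1 of the paper).
Under the synchronization FIM setup, if all the series
`Δ_{ij} = Σ_{k=1}^∞ [P^k]_{ij}` converge, then all `Δ_{ij} ≥ 0`, `J` is invertible,
and the entries of `J⁻¹` are given by the stated formulas; equivalently
`J⁻¹ = (I + Σ_{k=1}^∞ P^k) · D̃⁻¹`. -/
theorem inverse_fim_structure {n : ℕ} (hn : 1 ≤ n)
    (A : Matrix (Fin n) (Fin n) ℝ) (hAsymm : A.IsSymm)
    (hA01 : ∀ i j, A i j = 0 ∨ A i j = 1) (hAdiag : ∀ i, A i i = 0)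
    (dA : Fin n → ℝ) (hdA : ∀ i, dA i = ∑ j, A i j)
    (dR : Fin n → ℕ) (ξ : Fin n → ℝ) (hξ : ∀ i, 0 ≤ ξ i)
    (c : ℝ) (hc : 0 < c)
    (hpos : ∀ i, 0 < c * (dA i + dR i) + ξ i)
    (Dt : Matrix (Fin n) (Fin n) ℝ)
    (hDt : Dt = Matrix.diagonal (fun i => c * (dA i + dR i) + ξ i))
    (P : Matrix (Fin n) (Fin n) ℝ)
    (hP : P = Matrix.diagonal (fun i => (c * (dA i + dR i) + ξ i)⁻¹) * (c • A))
    (J : Matrix (Fin n) (Fin n) ℝ)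
    (hJ : J = c • (Matrix.diagonal dA + Matrix.diagonal (fun i => (dR i : ℝ)) - A)
            + Matrix.diagonal ξ)
    (hΔ : ∀ i j, Summable (fun k : ℕ => (P ^ (k + 1)) i j)) :
    (∀ i j, 0 ≤ ∑' k : ℕ, (P ^ (k + 1)) i j) ∧
    IsUnit J ∧
    (∀ i, J⁻¹ i i = (1 + ∑' k : ℕ, (P ^ (k + 1)) i i) / (c * (dA i + dR i) + ξ i)) ∧
    (∀ i j, i ≠ j →
      J⁻¹ i j = (∑' k : ℕ, (P ^ (k + 1)) i j) / (c * (dA j + dR j) + ξ j)) ∧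
    J⁻¹ = (1 + ∑' k : ℕ, P ^ (k + 1)) * Dt⁻¹ := by
  have hS : Summable fun k : ℕ => P ^ (k + 1) :=
    Pi.summable.2 fun i => Pi.summable.2 fun j => hΔ i j
  have hS_apply : ∀ i j, (∑' k : ℕ, P ^ (k + 1)) i j = ∑' k : ℕ, (P ^ (k + 1)) i j := by
    intro i j
    exact (Pi.hasSum.1 (Pi.hasSum.1 hS.hasSum i) j).tsum_eq.symm
  have hS' : Summable fun k : ℕ => P ^ k := (summable_nat_add_iff 1).1 hS
  have hgeom : (1 - P) * (1 + ∑' k : ℕ, P ^ (k + 1)) = 1 := by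
    have h := hS'.one_sub_mul_tsum_pow
    rwa [hS'.tsum_eq_zero_add, pow_zero] at h
  have hA_nonneg : ∀ i j, 0 ≤ A i j := by
    intro i j
    rcases hA01 i j with h | h <;> simp [h]
  have hP_nonneg : ∀ i j, 0 ≤ P i j := by
    intro i j
    rw [hP, Matrix.diagonal_mul, Matrix.smul_apply, smul_eq_mul]
    exact mul_nonneg (inv_nonneg.2 (hpos i).le) (mul_nonneg hc.le (hA_nonneg i j))
  have hDt_mul_diagonal :
      Dt * Matrix.diagonal (fun i => (c * (dA i + dR i) + ξ i)⁻¹) = 1 := by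
    rw [hDt, Matrix.diagonal_mul_diagonal, ← Matrix.diagonal_one]
    congr 1
    funext i
    exact mul_inv_cancel₀ (hpos i).ne'
  have hDt_inv : Dt⁻¹ = Matrix.diagonal fun i => (c * (dA i + dR i) + ξ i)⁻¹ :=
    Matrix.inv_eq_right_inv hDt_mul_diagonal
  have hDt_mul : Dt * Dt⁻¹ = 1 := by rw [hDt_inv, hDt_mul_diagonal]
  have hJ_eq : J = Dt * (1 - P) := by
    have hDtP : Dt * P = c • A := by
      rw [hP, ← mul_assoc, hDt_mul_diagonal, one_mul]
    rw [mul_sub, mul_one, hDtP, hJ, hDt]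
    ext i j
    by_cases h : i = j
    · subst h
      simp
      ring
    · simp [h]
  have hJ_mul : J * ((1 + ∑' k : ℕ, P ^ (k + 1)) * Dt⁻¹) = 1 := by
    rw [hJ_eq, mul_assoc, ← mul_assoc (1 - P), hgeom, one_mul, hDt_mul]
  have hJ_inv : J⁻¹ = (1 + ∑' k : ℕ, P ^ (k + 1)) * Dt⁻¹ := Matrix.inv_eq_right_inv hJ_mul
  refine ⟨fun i j => tsum_nonneg fun k => P.pow_apply_nonneg hP_nonneg (k + 1) i j,
    IsUnit.of_mul_eq_one _ hJ_mul, fun i => ?_, fun i j hij => ?_, hJ_inv⟩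
  · rw [hJ_inv, hDt_inv, Matrix.mul_diagonal, Matrix.add_apply, hS_apply, Matrix.one_apply_eq,
      div_eq_mul_inv]
  · rw [hJ_inv, hDt_inv, Matrix.mul_diagonal, Matrix.add_apply, hS_apply,
      Matrix.one_apply_ne hij, zero_add, div_eq_mul_inv]
end

section
/- Under the synchronization FIM setup, if for every index i the diagonal series Σ_{k=1}^∞ [P^k]_{ii} converges (i.e., every agent has finite cooperative dilution intensity), then for every pair (i,j) the series Σ_{k=1}^∞ [P^k]_{ij} converges, and the matrix J is invertible. -/
open Matrix Filter Topology

section NonnegMatrix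

variable {ι : Type*} [Fintype ι] [DecidableEq ι]

/-- If `D = diagonal d` symmetrizes `P`, then it symmetrizes every power of `P`. -/
theorem diagonal_mul_pow_isSymm {d : ι → ℝ} {P : Matrix ι ι ℝ}
    (h : (diagonal d * P).IsSymm) (k : ℕ) : (diagonal d * P ^ k).IsSymm := by
  have h' : Pᵀ * diagonal d = diagonal d * P := by
    simpa [Matrix.IsSymm, transpose_mul] using h
  have key : (Pᵀ) ^ k * diagonal d = diagonal d * P ^ k := by
    induction k with
    | zero => simp
    | succ k ih => rw [pow_succ, Matrix.mul_assoc, h', ← Matrix.mul_assoc, ih, Matrix.mul_assoc,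
        pow_succ]
  simpa [Matrix.IsSymm, transpose_mul, transpose_pow] using key

/-- For a nonnegative matrix symmetrized by a positive diagonal matrix, summability of the diagonal
entries of the powers implies summability of all entries. -/
theorem summable_pow_apply_of_summable_diag {d : ι → ℝ} (hd : ∀ i, 0 < d i) {P : Matrix ι ι ℝ}
    (hP : ∀ i j, 0 ≤ P i j) (hsymm : (diagonal d * P).IsSymm)
    (hdiag : ∀ i, Summable fun k : ℕ => (P ^ (k + 1)) i i) (i j : ι) :
    Summable fun k : ℕ => (P ^ (k + 1)) i j := by
  by_cases hzero : ∀ k : ℕ, (P ^ (k + 1)) i j = 0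
  · simpa only [hzero] using summable_zero
  push Not at hzero
  obtain ⟨m, hm⟩ := hzero
  have hpos : 0 < (P ^ (m + 1)) j i := by
    have hij := (pow_apply_nonneg hP (m + 1) i j).lt_of_ne' hm
    have hswap := (diagonal_mul_pow_isSymm hsymm (m + 1)).apply i j
    rw [diagonal_mul, diagonal_mul] at hswap
    exact pos_of_mul_pos_right (hswap ▸ mul_pos (hd i) hij) (hd j).le
  refine (summable_mul_right_iff hpos.ne').1 (Summable.of_nonneg_of_le
    (fun k => mul_nonneg (pow_apply_nonneg hP _ _ _) hpos.le) (fun k => ?_)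
    ((summable_nat_add_iff (m + 1)).2 (hdiag i)))
  rw [show k + (m + 1) + 1 = (k + 1) + (m + 1) by ring, pow_add P (k + 1), Matrix.mul_apply]
  exact Finset.single_le_sum (f := fun l => (P ^ (k + 1)) i l * (P ^ (m + 1)) l i)
    (fun l _ => mul_nonneg (pow_apply_nonneg hP _ _ _) (pow_apply_nonneg hP _ _ _))
    (Finset.mem_univ j)

/-- If the powers of `P` tend to zero entrywise, then `1 - P` is invertible. -/
theorem isUnit_one_sub_of_tendsto_pow_apply {P : Matrix ι ι ℝ}
    (h : ∀ i j, Tendsto (fun k : ℕ => (P ^ (k + 1)) i j) atTop (𝓝 0)) : IsUnit (1 - P) := by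
  rw [← Matrix.mulVec_injective_iff_isUnit, ← Matrix.coe_mulVecLin, injective_iff_map_eq_zero]
  intro v hv
  have hfix : P *ᵥ v = v := by
    rw [Matrix.mulVecLin_apply, Matrix.sub_mulVec, Matrix.one_mulVec, sub_eq_zero] at hv
    exact hv.symm
  have hpow (k : ℕ) : P ^ k *ᵥ v = v := by
    induction k with
    | zero => simp
    | succ k ih => rw [pow_succ, ← Matrix.mulVec_mulVec, hfix, ih]
  funext i
  have hlim : Tendsto (fun k : ℕ => (P ^ (k + 1) *ᵥ v) i) atTop (𝓝 (∑ j, 0 * v j)) :=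
    tendsto_finsetSum _ fun j _ => (h i j).mul_const (v j)
  simp only [hpow, zero_mul, Finset.sum_const_zero] at hlim
  exact tendsto_nhds_unique tendsto_const_nhds hlim

end NonnegMatrix


/-- Under the synchronization FIM setup, if every diagonal series
`Σ_{k=1}^∞ [P^k]_{ii}` converges (every agent has finite CDI), then every series
`Σ_{k=1}^∞ [P^k]_{ij}` converges and `J` is invertible. -/
theorem fim_invertible_of_finite_cdi {n : ℕ} (hn : 1 ≤ n)
    (A : Matrix (Fin n) (Fin n) ℝ) (hAsymm : A.IsSymm)
    (hA01 : ∀ i j, A i j = 0 ∨ A i j = 1) (hAdiag : ∀ i, A i i = 0)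
    (dA : Fin n → ℝ) (hdA : ∀ i, dA i = ∑ j, A i j)
    (dR : Fin n → ℕ) (ξ : Fin n → ℝ) (hξ : ∀ i, 0 ≤ ξ i)
    (c : ℝ) (hc : 0 < c)
    (hpos : ∀ i, 0 < c * (dA i + dR i) + ξ i)
    (P : Matrix (Fin n) (Fin n) ℝ)
    (hP : P = Matrix.diagonal (fun i => (c * (dA i + dR i) + ξ i)⁻¹) * (c • A))
    (J : Matrix (Fin n) (Fin n) ℝ)
    (hJ : J = c • (Matrix.diagonal dA + Matrix.diagonal (fun i => (dR i : ℝ)) - A)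
            + Matrix.diagonal ξ)
    (hdiag : ∀ i, Summable (fun k : ℕ => (P ^ (k + 1)) i i)) :
    (∀ i j, Summable (fun k : ℕ => (P ^ (k + 1)) i j)) ∧ IsUnit J := by
  set d : Fin n → ℝ := fun i => c * (dA i + dR i) + ξ i with hd
  have hdP : diagonal d * P = c • A := by
    rw [hP, ← Matrix.mul_assoc, diagonal_mul_diagonal]
    simp [fun i => mul_inv_cancel₀ (hpos i).ne', hd]
  have hPnonneg (i j : Fin n) : 0 ≤ P i j := by
    rw [hP, diagonal_mul, Matrix.smul_apply, smul_eq_mul]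
    have hA : 0 ≤ A i j := by rcases hA01 i j with h | h <;> simp [h]
    exact mul_nonneg (inv_nonneg.2 (hpos i).le) (mul_nonneg hc.le hA)
  have hsum := summable_pow_apply_of_summable_diag (d := d) hpos hPnonneg
    (hdP ▸ hAsymm.smul c) hdiag
  refine ⟨hsum, ?_⟩
  have hfactor : J = diagonal d * (1 - P) := by
    rw [Matrix.mul_sub, hdP, Matrix.mul_one, hJ]
    ext i j
    by_cases hij : i = j
    · subst hij
      simp [hd]
      ring
    · simp [hij]
  rw [hfactor]
  refine IsUnit.mul ?_ (isUnit_one_sub_of_tendsto_pow_apply fun i j =>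
    (hsum i j).tendsto_atTop_zero)
  rw [Matrix.isUnit_diagonal, Pi.isUnit_iff]
  exact fun i => (hpos i).ne'.isUnit
end

section
/- Let G be a connected simple graph on n ≥ 2 vertices, so all degrees d_i ≥ 1, let P = D^{-1}A be its random-walk transition matrix, let m = Σ_i d_i, and let Π be the n×n matrix with entries Π_{ij} = d_j/m (i.e., Π = 𝟙πᵀ with π the stationary distribution π_j = d_j/m). Then: (a) PΠ = ΠP = Π = Π²; (b) I − P + Π is invertible; and (c) for every c > 0, the matrix X = c^{-1}·C·(I − P + Π)^{-1}·D^{-1}·C, with C = I − (1/n)·𝟙𝟙ᵀ the centering matrix, is a Moore–Penrose pseudoinverse of J = c·(D − A): it satisfies all four Penrose equations for J. -/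
open Matrix

/-- Explicit Moore–Penrose pseudoinverse of the relative-synchronization FIM:
for a connected graph on `n ≥ 2` vertices with random-walk matrix `P = D⁻¹A`,
stationary matrix `Π` with entries `d_j/m` (`m = Σ_i d_i`), one has
`PΠ = ΠP = Π = Π²`, `I − P + Π` is invertible, and
`X = c⁻¹·C·(I − P + Π)⁻¹·D⁻¹·C` is a Moore–Penrose pseudoinverse of
`J = c·(D − A)`. -/
theorem explicit_pseudoinverse {n : ℕ} (hn : 2 ≤ n)
    (G : SimpleGraph (Fin n)) [DecidableRel G.Adj] (hG : G.Connected)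
    (A : Matrix (Fin n) (Fin n) ℝ) (hA : A = G.adjMatrix ℝ)
    (d : Fin n → ℝ) (hd : ∀ i, d i = ∑ j, A i j)
    (P : Matrix (Fin n) (Fin n) ℝ)
    (hP : P = Matrix.diagonal (fun i => (d i)⁻¹) * A)
    (m : ℝ) (hm : m = ∑ i, d i)
    (Pi : Matrix (Fin n) (Fin n) ℝ) (hPi : Pi = Matrix.of (fun _ j : Fin n => d j / m))
    (C : Matrix (Fin n) (Fin n) ℝ)
    (hC : C = 1 - (n : ℝ)⁻¹ • Matrix.of (fun _ _ : Fin n => (1 : ℝ)))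
    (c : ℝ) (hc : 0 < c)
    (J : Matrix (Fin n) (Fin n) ℝ) (hJ : J = c • (Matrix.diagonal d - A))
    (X : Matrix (Fin n) (Fin n) ℝ)
    (hX : X = c⁻¹ • (C * (1 - P + Pi)⁻¹ * Matrix.diagonal (fun i => (d i)⁻¹) * C)) :
    (P * Pi = Pi ∧ Pi * P = Pi ∧ Pi * Pi = Pi) ∧
    IsUnit (1 - P + Pi) ∧
    (J * X * J = J ∧ X * J * X = X ∧ (J * X)ᵀ = J * X ∧ (X * J)ᵀ = X * J) := by
  have hdeg : d = fun i => (G.degree i : ℝ) := by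
    funext i
    rw [hd i, hA, G.degree_eq_sum_if_adj]
    simp only [SimpleGraph.adjMatrix_apply]
  have hL : diagonal d - A = G.lapMatrix ℝ := by
    rw [hdeg, hA]
    rfl
  have hd0 : ∀ i, 0 < d i := by
    have : Nontrivial (Fin n) := Fin.nontrivial_iff_two_le.mpr hn
    intro i
    rw [hdeg]
    exact Nat.cast_pos.mpr (hG.preconnected.degree_pos_of_nontrivial i)
  have hn0 : (n : ℝ) ≠ 0 := by
    have : n ≠ 0 := by omega
    exact_mod_cast this
  have hm0 : m ≠ 0 := by
    rw [hm]
    exact (Finset.sum_pos (fun i _ => hd0 i) ⟨⟨0, by omega⟩, Finset.mem_univ _⟩).ne'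
  set L := diagonal d - A with hLdef
  set D := diagonal d with hDdef
  set K := diagonal (fun i => (d i)⁻¹) with hKdef
  set E : Matrix (Fin n) (Fin n) ℝ := of fun _ _ => 1 with hE
  have hDK : D * K = 1 := by
    rw [hDdef, hKdef, diagonal_mul_diagonal, ← diagonal_one]
    congr 1
    funext i
    exact mul_inv_cancel₀ (hd0 i).ne'
  have hKD : K * D = 1 := mul_eq_one_comm.mp hDK
  have hPL : P = 1 - K * L := by
    rw [hP, hLdef, mul_sub, hKD, sub_sub_cancel]
  have hLE : L * E = 0 := by
    ext i j
    simp [hLdef, hDdef, hE, mul_apply, diagonal_apply, hd i]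
  have hET : Eᵀ = E := rfl
  have hLT : Lᵀ = L := by rw [hL]; exact SimpleGraph.isSymm_lapMatrix ℝ G
  have hEL : E * L = 0 := by
    rw [← transpose_inj, transpose_mul, hET, hLT, hLE, transpose_zero]
  have hPiE : Pi = m⁻¹ • (E * D) := by
    rw [hPi]
    ext i j
    simp [hE, hDdef, div_eq_inv_mul]
  have hEDE : E * D * E = m • E := by
    ext i j
    simp [hE, hDdef, mul_apply, diagonal_apply, hm]
  have hEE : E * E = (n : ℝ) • E := by
    ext i j
    simp [hE, mul_apply]
  have hEC : E * C = 0 := by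
    rw [hC, mul_sub, mul_smul_comm, hEE, smul_smul, inv_mul_cancel₀ hn0, one_smul, mul_one,
      sub_self]
  have hCE : C * E = 0 := by
    rw [hC, sub_mul, smul_mul_assoc, hEE, smul_smul, inv_mul_cancel₀ hn0, one_smul, one_mul,
      sub_self]
  have hCL : C * L = L := by
    rw [hC, sub_mul, smul_mul_assoc, hEL, smul_zero, one_mul, sub_zero]
  have hCC : C * C = C := by
    nth_rewrite 1 [hC]
    rw [sub_mul, smul_mul_assoc, hEC, smul_zero, one_mul, sub_zero]
  have hCT : Cᵀ = C := by
    rw [hC, transpose_sub, transpose_smul, hET, transpose_one]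
  have hPPi : P * Pi = Pi := by
    rw [hPL, hPiE, sub_mul, one_mul, mul_smul_comm, ← mul_assoc, mul_assoc K, hLE]
    simp
  have hPiP : Pi * P = Pi := by
    rw [hPL, hPiE, mul_sub, mul_one, smul_mul_assoc, mul_assoc E, ← mul_assoc D, hDK, one_mul,
      hEL]
    simp
  have hPiPi : Pi * Pi = Pi := by
    rw [hPiE, smul_mul_smul_comm, ← mul_assoc, hEDE, smul_mul_assoc, smul_smul, mul_assoc,
      inv_mul_cancel₀ hm0, mul_one]
  set M := 1 - P + Pi with hM
  have hPiM : Pi * M = Pi := by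
    rw [hM, mul_add, mul_sub, mul_one, hPiP, hPiPi, sub_self, zero_add]
  have hMPi : M * Pi = Pi := by
    rw [hM, add_mul, sub_mul, one_mul, hPPi, hPiPi, sub_self, zero_add]
  have hMKL : M = K * L + Pi := by
    rw [hM, hPL, sub_sub_cancel]
  have hunit : IsUnit M := by
    rw [← mulVec_injective_iff_isUnit]
    refine (injective_iff_map_eq_zero M.mulVecLin).mpr fun v hv => ?_
    rw [mulVecLin_apply] at hv
    have hPiv : Pi *ᵥ v = 0 := by
      rw [← hPiM, ← mulVec_mulVec, hv, mulVec_zero]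
    have hLv : L *ᵥ v = 0 := by
      rw [hMKL, add_mulVec, hPiv, add_zero] at hv
      rw [← one_mul L, ← hDK, mul_assoc, ← mulVec_mulVec, hv, mulVec_zero]
    rw [hL, G.lapMatrix_mulVec_eq_zero_iff_forall_reachable] at hLv
    funext i
    have hi := congrFun hPiv i
    simp only [mulVec, dotProduct, hPi, of_apply, _root_.Pi.zero_apply] at hi
    rw [Finset.sum_congr rfl fun j _ => by rw [hLv j i (hG.preconnected j i)],
      ← Finset.sum_mul, ← Finset.sum_div, ← hm, div_self hm0, one_mul] at hi
    exact hi
  have hdet : IsUnit M.det := (isUnit_iff_isUnit_det M).mp hunit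
  have hKLM : K * L = M - Pi := by rw [hMKL, add_sub_cancel_right]
  have hinvPi : M⁻¹ * Pi = Pi := by
    nth_rewrite 1 [← hMPi]
    rw [← mul_assoc, nonsing_inv_mul M hdet, one_mul]
  have hPiinv : Pi * M⁻¹ = Pi := by
    nth_rewrite 1 [← hPiM]
    rw [mul_assoc, mul_nonsing_inv M hdet, mul_one]
  have hXJ : X * J = C := by
    calc X * J = C * (M⁻¹ * (K * (C * L))) := by
          rw [hX, hJ, smul_mul_smul_comm, inv_mul_cancel₀ hc.ne', one_smul]
          simp only [mul_assoc]
      _ = C := by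
          rw [hCL, hKLM, mul_sub, nonsing_inv_mul M hdet, hinvPi, mul_sub, hPiE, mul_smul_comm,
            ← mul_assoc, hCE, zero_mul, smul_zero, mul_one, sub_zero]
  have hJX : J * X = C := by
    have hLC : L * C = L := by
      rw [← transpose_inj, transpose_mul, hCT, hLT, hCL]
    calc J * X = L * C * M⁻¹ * K * C := by
          rw [hX, hJ, smul_mul_smul_comm, mul_inv_cancel₀ hc.ne', one_smul]
          simp only [mul_assoc]
      _ = D * ((K * L) * M⁻¹) * K * C := by
          rw [hLC, ← mul_assoc, ← mul_assoc D, hDK, one_mul]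
      _ = D * K * C - m⁻¹ • (D * (E * (D * K) * C)) := by
          rw [hKLM, sub_mul, mul_nonsing_inv M hdet, hPiinv, hPiE]
          simp only [mul_sub, sub_mul, mul_one, mul_smul_comm, smul_mul_assoc, mul_assoc]
      _ = C := by
          rw [hDK, mul_one, hEC, mul_zero, smul_zero, sub_zero, one_mul]
  have hCJ : C * J = J := by rw [hJ, mul_smul_comm, hCL]
  have hCX : C * X = X := by
    rw [hX, mul_smul_comm]
    simp only [← mul_assoc, hCC]
  exact ⟨⟨hPPi, hPiP, hPiPi⟩, hunit, by rw [hJX, hCJ], by rw [hXJ, hCX], by rw [hJX, hCT],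
    by rw [hXJ, hCT]⟩
end

section
/- Let G be a connected simple graph on n ≥ 2 vertices with all degrees d_i ≥ 1, let P = D^{-1}A be its random-walk transition matrix, and let S = D^{-1/2}·A·D^{-1/2} (a real symmetric matrix similar to P). Suppose the eigenvalue 1 of S is simple and that there is a real λ_slem < 1 such that every eigenvalue λ of S other than this simple eigenvalue 1 satisfies |λ| ≤ λ_slem. Then the series Σ_{k=1}^∞ (tr(P^k) − 1) converges and Σ_{k=1}^∞ (tr(P^k) − 1) ≤ tr(P²)/(1 − λ_slem), where moreover tr(P²) = Σ_i Σ_{j adjacent to i} 1/(d_i·d_j). -/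
open Matrix Filter Topology

namespace Matrix

/-- The trace of a power of a product does not depend on the order of the two factors. -/
theorem trace_mul_pow_comm {m R : Type*} [Fintype m] [DecidableEq m] [CommRing R]
    (M N : Matrix m m R) (k : ℕ) : ((M * N) ^ k).trace = ((N * M) ^ k).trace := by
  cases k with
  | zero => simp
  | succ k =>
    have key : (M * N) ^ k * M = M * (N * M) ^ k :=
      (SemiconjBy.pow_right (show SemiconjBy M (N * M) (M * N) by
        simp [SemiconjBy, Matrix.mul_assoc]) k).eq.symm
    rw [pow_succ, ← Matrix.mul_assoc, key, Matrix.mul_assoc, Matrix.trace_mul_comm,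
      Matrix.mul_assoc, ← pow_succ]

/-- The trace of a power of a Hermitian matrix is the power sum of its eigenvalues. -/
theorem IsHermitian.trace_pow_eq_sum_eigenvalues_pow {m : Type*} [Fintype m] [DecidableEq m]
    {M : Matrix m m ℝ} (hM : M.IsHermitian) (k : ℕ) :
    (M ^ k).trace = ∑ i, hM.eigenvalues i ^ k := by
  conv_lhs => rw [hM.spectral_theorem]
  rw [← map_pow, Unitary.conjStarAlgAut_apply, Matrix.trace_mul_comm, ← Matrix.mul_assoc]
  simp [Matrix.diagonal_pow, Matrix.trace_diagonal]

end Matrix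

/-- Spectral bound on the relative CDI series (used for Proposition 6 of the
paper): if the symmetrized random-walk matrix `S = D^{-1/2} A D^{-1/2}` has a
simple eigenvalue `1` and all its other eigenvalues have modulus at most
`λ_slem < 1`, then `Σ_{k≥1} (tr(P^k) − 1)` converges, is bounded by
`tr(P²)/(1 − λ_slem)`, and `tr(P²) = Σ_i Σ_{j ~ i} 1/(d_i d_j)`. -/
theorem slem_trace_bound {n : ℕ} (hn : 2 ≤ n)
    (G : SimpleGraph (Fin n)) [DecidableRel G.Adj] (hG : G.Connected)
    (A : Matrix (Fin n) (Fin n) ℝ) (hA : A = G.adjMatrix ℝ)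
    (d : Fin n → ℝ) (hd : ∀ i, d i = ∑ j, A i j)
    (P : Matrix (Fin n) (Fin n) ℝ)
    (hP : P = Matrix.diagonal (fun i => (d i)⁻¹) * A)
    (S : Matrix (Fin n) (Fin n) ℝ)
    (hS : S = Matrix.diagonal (fun i => (Real.sqrt (d i))⁻¹) * A *
      Matrix.diagonal (fun i => (Real.sqrt (d i))⁻¹))
    (hHerm : S.IsHermitian)
    (lamslem : ℝ) (hlam : lamslem < 1) (i₀ : Fin n)
    (h1 : hHerm.eigenvalues i₀ = 1)
    (hother : ∀ i, i ≠ i₀ → |hHerm.eigenvalues i| ≤ lamslem) :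
    Summable (fun k : ℕ => (P ^ (k + 1)).trace - 1) ∧
    (∑' k : ℕ, ((P ^ (k + 1)).trace - 1)) ≤ (P ^ 2).trace / (1 - lamslem) ∧
    (P ^ 2).trace = ∑ i, ∑ j ∈ G.neighborFinset i, (d i * d j)⁻¹ := by
  have hd0 : ∀ i, 0 ≤ d i := fun i => by
    rw [hd, hA]
    exact Finset.sum_nonneg fun j _ => by
      rw [SimpleGraph.adjMatrix_apply]; split_ifs <;> norm_num
  have htr : ∀ k, (P ^ k).trace = ∑ i, hHerm.eigenvalues i ^ k := fun k => by
    rw [← hHerm.trace_pow_eq_sum_eigenvalues_pow, hS, Matrix.trace_mul_pow_comm,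
      ← Matrix.mul_assoc, Matrix.diagonal_mul_diagonal, hP]
    simp [← mul_inv, Real.mul_self_sqrt (hd0 _)]
  have hsplit : ∀ k, (P ^ k).trace - 1 =
      ∑ i ∈ Finset.univ.erase i₀, hHerm.eigenvalues i ^ k := fun k => by
    rw [htr, ← Finset.add_sum_erase _ _ (Finset.mem_univ i₀), h1, one_pow, add_sub_cancel_left]
  have hPij : ∀ i j, P i j = (d i)⁻¹ * if G.Adj i j then 1 else 0 := fun i j => by
    rw [hP, Matrix.diagonal_mul, hA, SimpleGraph.adjMatrix_apply]
  have htrP : P.trace = 0 := by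
    simp [Matrix.trace, hPij]
  have hsum : HasSum (fun k : ℕ => (P ^ (k + 1)).trace - 1)
      (∑ i ∈ Finset.univ.erase i₀, (1 - hHerm.eigenvalues i)⁻¹ * hHerm.eigenvalues i) := by
    simp_rw [hsplit]
    refine hasSum_sum fun i hi => ?_
    simp_rw [pow_succ]
    refine (hasSum_geometric_of_abs_lt_one ?_).mul_right _
    exact (hother i (Finset.ne_of_mem_erase hi)).trans_lt hlam
  have hlam' : 0 < 1 - lamslem := sub_pos.2 hlam
  refine ⟨hsum.summable, ?_, ?_⟩
  · rw [hsum.tsum_eq]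
    have hone := hsplit 1
    have htwo := hsplit 2
    simp only [pow_one, htrP] at hone
    have hterm : ∀ i ∈ Finset.univ.erase i₀,
        (1 - hHerm.eigenvalues i)⁻¹ * hHerm.eigenvalues i ≤
          hHerm.eigenvalues i + hHerm.eigenvalues i ^ 2 / (1 - lamslem) := fun i hi => by
      have hle : hHerm.eigenvalues i ≤ lamslem :=
        (le_abs_self _).trans (hother i (Finset.ne_of_mem_erase hi))
      have hpos : 0 < 1 - hHerm.eigenvalues i := by linarith
      calc (1 - hHerm.eigenvalues i)⁻¹ * hHerm.eigenvalues i
          = hHerm.eigenvalues i + hHerm.eigenvalues i ^ 2 / (1 - hHerm.eigenvalues i) := by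
            field_simp; ring
        _ ≤ _ := by gcongr
    refine (Finset.sum_le_sum hterm).trans ?_
    rw [Finset.sum_add_distrib, ← Finset.sum_div, ← hone, ← htwo, sub_div]
    have : 0 < 1 / (1 - lamslem) := by positivity
    linarith
  · simp only [Matrix.trace, Matrix.diag_apply, pow_two, Matrix.mul_apply, hPij,
      SimpleGraph.neighborFinset_eq_filter, Finset.sum_filter]
    refine Finset.sum_congr rfl fun i _ => Finset.sum_congr rfl fun j _ => ?_
    by_cases h : G.Adj i j
    · simp [h, h.symm, mul_comm]
    · simp [h]
end

section
/- Let J be an n×n real symmetric matrix with J·𝟙 = 0 and rank(J) = n − 1 (so the kernel of J is exactly the span of the all-ones vector 𝟙), and let X be a Moore–Penrose pseudoinverse of J. Let B be an n×n diagonal matrix with strictly positive diagonal entries, let v = B·𝟙, and let C_s = I − v·vᵀ/‖v‖². Then C_s·B·X·B·C_s is a Moore–Penrose pseudoinverse of B^{-1}·J·B^{-1}. (Pseudoinverse of the relative-synchronization Fisher information matrix in the presence of known clock skews.) -/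
open Matrix

/-- `X` is a Moore–Penrose pseudoinverse of `M`. -/
def IsMoorePenroseInv {n : ℕ} (M X : Matrix (Fin n) (Fin n) ℝ) : Prop :=
  M * X * M = M ∧ X * M * X = X ∧ (M * X)ᵀ = M * X ∧ (X * M)ᵀ = X * M

/-- If the kernel of `J` is spanned by the all-ones vector, then every `A` with `J * A = 0` has
constant columns. -/
lemma exists_eq_vecMulVec_one_of_mul_eq_zero {n : ℕ} (hn : 0 < n)
    {J A : Matrix (Fin n) (Fin n) ℝ} (hker : J *ᵥ (fun _ => 1) = 0) (hrank : J.rank = n - 1)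
    (hA : J * A = 0) : ∃ w : Fin n → ℝ, A = vecMulVec (fun _ => 1) w := by
  have hfin : Module.finrank ℝ (LinearMap.ker J.mulVecLin) = 1 := by
    have h := J.mulVecLin.finrank_range_add_finrank_ker
    rw [Module.finrank_fin_fun] at h
    change J.rank + _ = n at h
    omega
  have hone : (⟨fun _ => 1, hker⟩ : LinearMap.ker J.mulVecLin) ≠ 0 := fun h =>
    one_ne_zero (congrFun (congrArg Subtype.val h) ⟨0, hn⟩)
  have hcol (j : Fin n) : ∃ c : ℝ, ∀ i, A i j = c := by
    have hj : J *ᵥ A.col j = 0 := by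
      ext i
      exact congrFun (congrFun hA i) j
    obtain ⟨c, hc⟩ := (finrank_eq_one_iff_of_nonzero' _ hone).1 hfin ⟨A.col j, hj⟩
    refine ⟨c, fun i => ?_⟩
    have := congrFun (congrArg Subtype.val hc) i
    simpa using this.symm
  choose w hw using hcol
  exact ⟨w, by ext i j; simp [vecMulVec_apply, hw]⟩

/-- Pseudoinverse of the relative-synchronization FIM in the presence of known
clock skews: if `J` is symmetric with `J𝟙 = 0` and `rank J = n − 1`, `X` is a
Moore–Penrose pseudoinverse of `J`, `B` is diagonal with positive entries,
`v = B𝟙` and `C_s = I − vvᵀ/‖v‖²`, then `C_s·B·X·B·C_s` is a Moore–Penrose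
pseudoinverse of `B⁻¹·J·B⁻¹`. -/
theorem skew_pseudoinverse {n : ℕ}
    (J X : Matrix (Fin n) (Fin n) ℝ) (hsymm : J.IsSymm)
    (hker : J.mulVec (fun _ => 1) = 0)
    (hrank : J.rank = n - 1)
    (hX : IsMoorePenroseInv J X)
    (b : Fin n → ℝ) (hb : ∀ i, 0 < b i)
    (B : Matrix (Fin n) (Fin n) ℝ) (hB : B = Matrix.diagonal b)
    (v : Fin n → ℝ) (hv : v = B.mulVec (fun _ => 1))
    (Cs : Matrix (Fin n) (Fin n) ℝ)
    (hCs : Cs = 1 - (∑ i, v i ^ 2)⁻¹ • Matrix.vecMulVec v v) :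
    IsMoorePenroseInv (B⁻¹ * J * B⁻¹) (Cs * B * X * B * Cs) := by
  obtain ⟨h1, h2, h3, h4⟩ := hX
  rcases Nat.eq_zero_or_pos n with rfl | hn
  · exact ⟨Subsingleton.elim _ _, Subsingleton.elim _ _, Subsingleton.elim _ _,
      Subsingleton.elim _ _⟩
  have hvb : v = b := by
    ext i
    simp [hv, hB, mulVec_diagonal]
  have hpos : 0 < ∑ i, v i ^ 2 :=
    Finset.sum_pos (fun i _ => by rw [hvb]; exact pow_pos (hb i) 2) ⟨⟨0, hn⟩, Finset.mem_univ _⟩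
  have hBu : IsUnit B.det := by
    rw [hB, det_diagonal]
    exact (Finset.prod_pos fun i _ => hb i).ne'.isUnit
  have hBB : B * B⁻¹ = 1 := mul_nonsing_inv B hBu
  have hBB' : B⁻¹ * B = 1 := nonsing_inv_mul B hBu
  have hBt : Bᵀ = B := by rw [hB, diagonal_transpose]
  have hCt : Csᵀ = Cs := by
    rw [hCs, transpose_sub, transpose_one, transpose_smul, transpose_vecMulVec]
  have hCv : Cs *ᵥ v = 0 := by
    have hd : v ⬝ᵥ v = ∑ i, v i ^ 2 := by simp only [dotProduct, sq]
    rw [hCs, sub_mulVec, one_mulVec, smul_mulVec, vecMulVec_mulVec, hd]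
    ext i
    simp
    field_simp
    simp
  have hMv : (B⁻¹ * J * B⁻¹) *ᵥ v = 0 := by
    rw [hv, mulVec_mulVec, Matrix.mul_assoc _ B⁻¹ B, hBB', Matrix.mul_one, ← mulVec_mulVec, hker,
      mulVec_zero]
  have hMt : (B⁻¹ * J * B⁻¹)ᵀ = B⁻¹ * J * B⁻¹ := by
    rw [transpose_mul, transpose_mul, transpose_nonsing_inv, hBt, hsymm.eq, Matrix.mul_assoc]
  have hMC : B⁻¹ * J * B⁻¹ * Cs = B⁻¹ * J * B⁻¹ := by
    rw [hCs, Matrix.mul_sub, Matrix.mul_one, Matrix.mul_smul, mul_vecMulVec, hMv]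
    simp
  have hCM : Cs * (B⁻¹ * J * B⁻¹) = B⁻¹ * J * B⁻¹ := by
    simpa only [transpose_mul (B⁻¹ * J * B⁻¹) Cs, hMt, hCt] using congrArg transpose hMC
  have hCC : Cs * Cs = Cs := by
    nth_rewrite 2 [hCs]
    rw [Matrix.mul_sub, Matrix.mul_one, Matrix.mul_smul, mul_vecMulVec, hCv]
    simp
  have hJXJ : J * (1 - X * J) = 0 := by
    rw [Matrix.mul_sub, Matrix.mul_one, ← Matrix.mul_assoc, h1, sub_self]
  have hJJX : J * (1 - J * X) = 0 := by
    have := congrArg transpose (show (1 - J * X) * J = 0 by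
      rw [Matrix.sub_mul, Matrix.one_mul, h1, sub_self])
    simpa only [transpose_mul (1 - J * X) J, transpose_sub, transpose_one, h3, hsymm.eq,
      transpose_zero] using this
  obtain ⟨w, hw⟩ := exists_eq_vecMulVec_one_of_mul_eq_zero hn hker hrank hJXJ
  obtain ⟨u, hu⟩ := exists_eq_vecMulVec_one_of_mul_eq_zero hn hker hrank hJJX
  have hXJ : Cs * B * (X * J) = Cs * B := by
    have h : Cs * B * (1 - X * J) = 0 := by
      rw [hw, mul_vecMulVec, ← mulVec_mulVec, ← hv, hCv]
      simp
    rwa [Matrix.mul_sub, Matrix.mul_one, sub_eq_zero, eq_comm] at h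
  have hJX : J * X * (B * Cs) = B * Cs := by
    have h : Cs * B * (1 - J * X) = 0 := by
      rw [hu, mul_vecMulVec, ← mulVec_mulVec, ← hv, hCv]
      simp
    rw [Matrix.mul_sub, Matrix.mul_one, sub_eq_zero, eq_comm] at h
    simpa only [transpose_mul (Cs * B), transpose_mul Cs B, h3, hCt, hBt] using
      congrArg transpose h
  have hMY : B⁻¹ * J * B⁻¹ * (Cs * B * X * B * Cs) = Cs := by
    calc B⁻¹ * J * B⁻¹ * (Cs * B * X * B * Cs)
        = B⁻¹ * J * B⁻¹ * Cs * (B * X * B * Cs) := by simp only [Matrix.mul_assoc]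
      _ = B⁻¹ * J * (B⁻¹ * B) * X * B * Cs := by rw [hMC]; simp only [Matrix.mul_assoc]
      _ = B⁻¹ * (J * X * (B * Cs)) := by rw [hBB', Matrix.mul_one]; simp only [Matrix.mul_assoc]
      _ = Cs := by rw [hJX, ← Matrix.mul_assoc, hBB', Matrix.one_mul]
  have hYM : Cs * B * X * B * Cs * (B⁻¹ * J * B⁻¹) = Cs := by
    calc Cs * B * X * B * Cs * (B⁻¹ * J * B⁻¹)
        = Cs * B * X * B * (B⁻¹ * J * B⁻¹) := by rw [Matrix.mul_assoc _ Cs, hCM]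
      _ = Cs * B * X * (B * B⁻¹) * J * B⁻¹ := by simp only [Matrix.mul_assoc]
      _ = Cs * B * (X * J) * B⁻¹ := by rw [hBB, Matrix.mul_one]; simp only [Matrix.mul_assoc]
      _ = Cs := by rw [hXJ, Matrix.mul_assoc, hBB, Matrix.mul_one]
  refine ⟨by rw [hMY, hCM], ?_, by rw [hMY, hCt], by rw [hYM, hCt]⟩
  rw [hYM]
  simp only [← Matrix.mul_assoc, hCC]
end

section
/- Let (Ω, μ) be a probability space, let α : Ω → ℝⁿ be a random vector such that each component α_i is integrable with E[α_i] = 1 and each product α_i·α_j is integrable, and let M be a real symmetric positive semidefinite n×n matrix. Then for every x ∈ ℝⁿ, E[ ((diag α)·x)ᵀ · M · ((diag α)·x) ] ≥ xᵀ·M·x, where (diag α)·x denotes the vector with components α_i·x_i. (Hence, for clock skews with mean 1, E[B·J^{-1}·B] ⪰ J^{-1} in the positive semidefinite order: introducing clock skews always degrades synchronization performance.) -/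
open Matrix MeasureTheory

theorem Matrix.PosSemidef.tangent_le_dotProduct_mulVec {ι : Type*} [Fintype ι]
    {M : Matrix ι ι ℝ} (hM : M.PosSemidef) (x y : ι → ℝ) :
    y ⬝ᵥ M *ᵥ x + x ⬝ᵥ M *ᵥ y - x ⬝ᵥ M *ᵥ x ≤ y ⬝ᵥ M *ᵥ y := by
  have h := hM.dotProduct_mulVec_nonneg (y - x)
  rw [star_trivial, mulVec_sub, sub_dotProduct, dotProduct_sub, dotProduct_sub] at h
  linarith

section Integral

variable {Ω ι : Type*} [MeasurableSpace Ω] {μ : Measure Ω} [Fintype ι] {Y : Ω → ι → ℝ}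

theorem MeasureTheory.Integrable.dotProduct_const (hY : ∀ i, Integrable (fun ω => Y ω i) μ)
    (v : ι → ℝ) : Integrable (fun ω => Y ω ⬝ᵥ v) μ :=
  integrable_finsetSum _ fun i _ => (hY i).mul_const (v i)

theorem MeasureTheory.integral_dotProduct_const (hY : ∀ i, Integrable (fun ω => Y ω i) μ)
    (v : ι → ℝ) : ∫ ω, Y ω ⬝ᵥ v ∂μ = (fun i => ∫ ω, Y ω i ∂μ) ⬝ᵥ v := by
  simp only [dotProduct]
  rw [integral_finsetSum _ fun i _ => (hY i).mul_const (v i)]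
  simp only [integral_mul_const]

theorem MeasureTheory.Integrable.dotProduct_mulVec_self
    (hYY : ∀ i j, Integrable (fun ω => Y ω i * Y ω j) μ) (M : Matrix ι ι ℝ) :
    Integrable (fun ω => Y ω ⬝ᵥ M *ᵥ Y ω) μ := by
  simp only [dotProduct, mulVec, Finset.mul_sum]
  refine integrable_finsetSum _ fun i _ => integrable_finsetSum _ fun j _ => ?_
  refine ((hYY i j).const_mul (M i j)).congr (.of_forall fun ω => ?_)
  ring

/-- Jensen's inequality for the quadratic form of a positive semidefinite matrix. -/
theorem Matrix.PosSemidef.dotProduct_mulVec_integral_le [IsProbabilityMeasure μ]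
    {M : Matrix ι ι ℝ} (hM : M.PosSemidef) (hY : ∀ i, Integrable (fun ω => Y ω i) μ)
    (hYY : ∀ i j, Integrable (fun ω => Y ω i * Y ω j) μ) :
    (fun i => ∫ ω, Y ω i ∂μ) ⬝ᵥ M *ᵥ (fun i => ∫ ω, Y ω i ∂μ) ≤
      ∫ ω, Y ω ⬝ᵥ M *ᵥ Y ω ∂μ := by
  set m : ι → ℝ := fun i => ∫ ω, Y ω i ∂μ with hm
  have hswap (y : ι → ℝ) : m ⬝ᵥ M *ᵥ y = y ⬝ᵥ m ᵥ* M := by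
    rw [dotProduct_mulVec, dotProduct_comm]
  have h₁ := Integrable.dotProduct_const hY (M *ᵥ m)
  have h₂ := Integrable.dotProduct_const hY (m ᵥ* M)
  have h₁₂ : Integrable (fun ω => Y ω ⬝ᵥ M *ᵥ m + Y ω ⬝ᵥ m ᵥ* M) μ := h₁.add h₂
  calc
    m ⬝ᵥ M *ᵥ m = ∫ ω, (Y ω ⬝ᵥ M *ᵥ m + Y ω ⬝ᵥ m ᵥ* M - m ⬝ᵥ M *ᵥ m) ∂μ := by
      rw [integral_sub h₁₂ (integrable_const _), integral_add h₁ h₂,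
        integral_dotProduct_const hY, integral_dotProduct_const hY, ← hm, ← hswap]
      simp
    _ ≤ ∫ ω, Y ω ⬝ᵥ M *ᵥ Y ω ∂μ := by
      refine integral_mono (h₁₂.sub (integrable_const _))
        (Integrable.dotProduct_mulVec_self hYY M) fun ω => ?_
      simpa only [hswap (Y ω)] using hM.tangent_le_dotProduct_mulVec m (Y ω)

end Integral

/-- Jensen-type inequality for clock skews (Section III-C of the paper): if the
random vector `α` has integrable components with mean `1` and integrable
pairwise products, and `M` is symmetric positive semidefinite, then
`E[((diag α)x)ᵀ M ((diag α)x)] ≥ xᵀ M x` for every `x`. -/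
theorem skew_degrades_performance {Ω : Type*} [MeasurableSpace Ω]
    (μ : Measure Ω) [IsProbabilityMeasure μ] {n : ℕ}
    (α : Ω → Fin n → ℝ)
    (hint : ∀ i, Integrable (fun ω => α ω i) μ)
    (hmean : ∀ i, ∫ ω, α ω i ∂μ = 1)
    (hprod : ∀ i j, Integrable (fun ω => α ω i * α ω j) μ)
    (M : Matrix (Fin n) (Fin n) ℝ) (hM : M.PosSemidef) :
    ∀ x : Fin n → ℝ,
      x ⬝ᵥ M.mulVec x ≤
        ∫ ω, (fun i => α ω i * x i) ⬝ᵥ M.mulVec (fun i => α ω i * x i) ∂μ := by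
  intro x
  have hY (i : Fin n) : Integrable (fun ω => α ω i * x i) μ := (hint i).mul_const (x i)
  have hYY (i j : Fin n) : Integrable (fun ω => α ω i * x i * (α ω j * x j)) μ :=
    ((hprod i j).mul_const (x i * x j)).congr (.of_forall fun ω => by ring)
  simpa only [integral_mul_const, hmean, one_mul] using
    hM.dotProduct_mulVec_integral_le (Y := fun ω i => α ω i * x i) hY hYY
end

section
/- Under the synchronization FIM setup, suppose that for every agent i there exists a finite walk in the agent graph from i to an agent with nonzero anchoring information; that is, there exist indices i = i_0, i_1, …, i_m with A_{i_{l} i_{l+1}} = 1 for all 0 ≤ l < m and c·d_R(i_m) + ξ(i_m) > 0. Then the spectral radius of P is strictly less than 1 (equivalently, the series Σ_{k=0}^∞ P^k converges), and J is symmetric positive definite (in particular invertible): the network is absolutely synchronizable. -/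
open Matrix

open Filter Topology

namespace Matrix

variable {ι : Type*} [Fintype ι]

/-- The Dirichlet form of a symmetric weight, as a sum of squares. -/
theorem sum_mul_sum_sub_eq {W : Matrix ι ι ℝ} (hW : W.IsSymm) (x : ι → ℝ) :
    ∑ i, x i * ∑ j, W i j * (x i - x j) = (∑ i, ∑ j, W i j * (x i - x j) ^ 2) / 2 := by
  have hswap : ∑ i, ∑ j, W i j * x i * (x i - x j) = ∑ i, ∑ j, W i j * x j * (x j - x i) := by
    rw [Finset.sum_comm]
    simp only [hW.apply]
  have hadd : ∑ i, ∑ j, W i j * (x i - x j) ^ 2 =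
      ∑ i, ∑ j, W i j * x i * (x i - x j) + ∑ i, ∑ j, W i j * x j * (x j - x i) := by
    simp only [← Finset.sum_add_distrib]
    exact Finset.sum_congr rfl fun i _ => Finset.sum_congr rfl fun j _ => by ring
  have hleft : ∑ i, x i * ∑ j, W i j * (x i - x j) = ∑ i, ∑ j, W i j * x i * (x i - x j) := by
    simp only [Finset.mul_sum]
    exact Finset.sum_congr rfl fun i _ => Finset.sum_congr rfl fun j _ => by ring
  linarith

/-- A weighted Laplacian plus a nonnegative potential is positive definite if every vertex is
connected to one where the potential is positive. -/
theorem posDef_of_mulVec_eq_laplacian_add {W M : Matrix ι ι ℝ} {a : ι → ℝ} (hM : M.IsHermitian)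
    (hMW : ∀ x i, (M *ᵥ x) i = ∑ j, W i j * (x i - x j) + a i * x i)
    (hW : W.IsSymm) (hW0 : ∀ i j, 0 ≤ W i j) (ha : ∀ i, 0 ≤ a i)
    (hreach : ∀ i, ∃ j, Relation.ReflTransGen (fun k l => 0 < W k l) i j ∧ 0 < a j) :
    M.PosDef := by
  refine .of_dotProduct_mulVec_pos hM fun x hx => ?_
  have hform : star x ⬝ᵥ M *ᵥ x =
      (∑ i, ∑ j, W i j * (x i - x j) ^ 2) / 2 + ∑ i, a i * x i ^ 2 := by
    rw [← sum_mul_sum_sub_eq hW, ← Finset.sum_add_distrib]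
    exact Finset.sum_congr rfl fun i _ => by rw [hMW, Pi.star_apply, star_trivial]; ring
  have hW2 : ∀ i j, 0 ≤ W i j * (x i - x j) ^ 2 := fun i j => mul_nonneg (hW0 i j) (sq_nonneg _)
  have ha2 : ∀ i, 0 ≤ a i * x i ^ 2 := fun i => mul_nonneg (ha i) (sq_nonneg _)
  have hrow : ∀ i, 0 ≤ ∑ j, W i j * (x i - x j) ^ 2 := fun i =>
    Finset.sum_nonneg fun j _ => hW2 i j
  have hsumW := Finset.sum_nonneg fun i (_ : i ∈ Finset.univ) => hrow i
  have hsuma := Finset.sum_nonneg fun i (_ : i ∈ Finset.univ) => ha2 i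
  rw [hform]
  by_contra! hle
  refine hx (funext fun i => ?_)
  obtain ⟨j, hij, hj⟩ := hreach i
  have hconst : x i = x j := by
    clear hj
    induction hij with
    | refl => rfl
    | @tail k l _ hkl ih =>
      have hk := (Finset.sum_eq_zero_iff_of_nonneg fun i _ => hrow i).1
        (le_antisymm (by linarith) hsumW) k (Finset.mem_univ k)
      have hl := (Finset.sum_eq_zero_iff_of_nonneg fun j _ => hW2 k j).1 hk l (Finset.mem_univ l)
      exact ih.trans (sub_eq_zero.1 (by simpa [hkl.ne'] using hl))
  have hzero := (Finset.sum_eq_zero_iff_of_nonneg fun i _ => ha2 i).1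
    (le_antisymm (by linarith) hsuma) j (Finset.mem_univ j)
  simpa [hconst, hj.ne'] using hzero

/-- Minimum principle for a weighted Laplacian plus a nonnegative potential. -/
theorem pos_of_laplacian_add_pos {W : Matrix ι ι ℝ} {a v : ι → ℝ} (hW0 : ∀ i j, 0 ≤ W i j)
    (ha : ∀ i, 0 ≤ a i) (hv : ∀ i, 0 < ∑ j, W i j * (v i - v j) + a i * v i) (i : ι) :
    0 < v i := by
  have : Nonempty ι := ⟨i⟩
  obtain ⟨k, hk⟩ := Finite.exists_min v
  refine lt_of_lt_of_le ?_ (hk i)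
  by_contra! hle
  have hsum : ∑ j, W k j * (v k - v j) ≤ 0 :=
    Finset.sum_nonpos fun j _ => mul_nonpos_of_nonneg_of_nonpos (hW0 k j) (sub_nonpos.2 (hk j))
  linarith [hv k, mul_nonpos_of_nonneg_of_nonpos (ha k) hle]

variable [DecidableEq ι]

/-- The Neumann series of a nonnegative matrix converges if the matrix strictly decreases some
positive vector. -/
theorem summable_pow_of_mulVec_lt {P : Matrix ι ι ℝ} {v : ι → ℝ} (hP : ∀ i j, 0 ≤ P i j)
    (hv : ∀ i, 0 < v i) (hPv : ∀ i, (P *ᵥ v) i < v i) : Summable fun k : ℕ => P ^ k := by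
  obtain ⟨ρ, hρ0, hρ1, hρ⟩ : ∃ ρ : ℝ, 0 ≤ ρ ∧ ρ < 1 ∧ ∀ i, (P *ᵥ v) i ≤ ρ * v i := by
    rcases isEmpty_or_nonempty ι with _ | _
    · exact ⟨0, le_rfl, one_pos, isEmptyElim⟩
    · obtain ⟨k, hk⟩ := Finite.exists_max fun i => (P *ᵥ v) i / v i
      refine ⟨(P *ᵥ v) k / v k, div_nonneg ?_ (hv k).le, (div_lt_one (hv k)).2 (hPv k),
        fun i => (div_le_iff₀ (hv i)).1 (hk i)⟩
      exact Finset.sum_nonneg fun j _ => mul_nonneg (hP k j) (hv j).le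
  have hpow0 : ∀ (k : ℕ) i j, 0 ≤ (P ^ k) i j := by
    intro k
    induction k with
    | zero => intro i j; rw [pow_zero, one_apply]; split_ifs <;> norm_num
    | succ k ih =>
      intro i j
      rw [pow_succ, mul_apply]
      exact Finset.sum_nonneg fun l _ => mul_nonneg (ih i l) (hP l j)
  have hpow : ∀ (k : ℕ) i, (P ^ k *ᵥ v) i ≤ ρ ^ k * v i := by
    intro k
    induction k with
    | zero => simp
    | succ k ih =>
      intro i
      calc (P ^ (k + 1) *ᵥ v) i = (P ^ k *ᵥ (P *ᵥ v)) i := by rw [pow_succ, mulVec_mulVec]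
        _ ≤ (P ^ k *ᵥ (ρ • v)) i :=
          Finset.sum_le_sum fun j _ => mul_le_mul_of_nonneg_left (hρ j) (hpow0 k i j)
        _ = ρ * (P ^ k *ᵥ v) i := by rw [mulVec_smul]; rfl
        _ ≤ ρ * (ρ ^ k * v i) := mul_le_mul_of_nonneg_left (ih i) hρ0
        _ = ρ ^ (k + 1) * v i := by ring
  refine Pi.summable.2 fun i => Pi.summable.2 fun j => ?_
  refine .of_nonneg_of_le (fun k => hpow0 k i j) (fun k => ?_)
    ((summable_geometric_of_lt_one hρ0 hρ1).mul_right (v i / v j))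
  rw [← mul_div_assoc, le_div_iff₀ (hv j)]
  exact (Finset.single_le_sum (f := fun l => (P ^ k) i l * v l)
    (fun l _ => mul_nonneg (hpow0 k i l) (hv l).le) (Finset.mem_univ j)).trans (hpow k i)

theorem norm_lt_one_of_mem_spectrum_of_tendsto_pow {Q : Matrix ι ι ℂ}
    (hQ : Tendsto (fun k : ℕ => Q ^ k) atTop (𝓝 0)) {μ : ℂ} (hμ : μ ∈ spectrum ℂ Q) :
    ‖μ‖ < 1 := by
  rw [← spectrum_toLin', ← Module.End.hasEigenvalue_iff_mem_spectrum] at hμ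
  obtain ⟨x, hx⟩ := hμ.exists_hasEigenvector
  obtain ⟨i, hi⟩ := Function.ne_iff.1 hx.2
  have hQx : ∀ k : ℕ, (Q ^ k *ᵥ x) i = μ ^ k * x i := fun k => by
    rw [← toLin'_apply, toLin'_pow, hx.pow_apply]
    rfl
  have hlim : Tendsto (fun k : ℕ => μ ^ k * x i) atTop (𝓝 0) := by
    simp only [← hQx]
    have hcont : Continuous fun R : Matrix ι ι ℂ => (R *ᵥ x) i := by fun_prop
    simpa [Function.comp_def] using (hcont.tendsto 0).comp hQ
  refine tendsto_pow_atTop_nhds_zero_iff_norm_lt_one.1 ?_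
  simpa [mul_div_cancel_right₀ _ hi] using hlim.div_const (x i)

end Matrix

/-- Absolute synchronizability (Remark 3 of the paper): if from every agent
there is a finite walk in the agent graph to an agent with nonzero anchoring
information (`c·d_R + ξ > 0`), then the spectral radius of `P` is strictly
less than `1` (equivalently `Σ_{k≥0} P^k` converges) and `J` is positive
definite, in particular invertible. -/
theorem absolute_synchronizability {n : ℕ} (hn : 1 ≤ n)
    (A : Matrix (Fin n) (Fin n) ℝ) (hAsymm : A.IsSymm)
    (hA01 : ∀ i j, A i j = 0 ∨ A i j = 1) (hAdiag : ∀ i, A i i = 0)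
    (dA : Fin n → ℝ) (hdA : ∀ i, dA i = ∑ j, A i j)
    (dR : Fin n → ℕ) (ξ : Fin n → ℝ) (hξ : ∀ i, 0 ≤ ξ i)
    (c : ℝ) (hc : 0 < c)
    (hpos : ∀ i, 0 < c * (dA i + dR i) + ξ i)
    (P : Matrix (Fin n) (Fin n) ℝ)
    (hP : P = Matrix.diagonal (fun i => (c * (dA i + dR i) + ξ i)⁻¹) * (c • A))
    (J : Matrix (Fin n) (Fin n) ℝ)
    (hJ : J = c • (Matrix.diagonal dA + Matrix.diagonal (fun i => (dR i : ℝ)) - A)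
            + Matrix.diagonal ξ)
    (hreach : ∀ i : Fin n, ∃ m : ℕ, ∃ w : Fin (m + 1) → Fin n,
      w 0 = i ∧ (∀ l : Fin m, A (w l.castSucc) (w l.succ) = 1) ∧
      0 < c * dR (w (Fin.last m)) + ξ (w (Fin.last m))) :
    (∀ μ ∈ spectrum ℂ (P.map (algebraMap ℝ ℂ)), ‖μ‖ < 1) ∧
    Summable (fun k : ℕ => P ^ k) ∧
    J.PosDef := by
  set W : Matrix (Fin n) (Fin n) ℝ := c • A with hWdef
  set a : Fin n → ℝ := fun i => c * dR i + ξ i with hadef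
  have hA0 : ∀ i j, 0 ≤ A i j := fun i j => by rcases hA01 i j with h | h <;> simp [h]
  have hW0 : ∀ i j, 0 ≤ W i j := fun i j => mul_nonneg hc.le (hA0 i j)
  have ha : ∀ i, 0 ≤ a i := fun i => add_nonneg (mul_nonneg hc.le (Nat.cast_nonneg _)) (hξ i)
  have hW : W.IsSymm := hAsymm.smul c
  have hWx : ∀ x i, (W *ᵥ x) i = c * ∑ j, A i j * x j := fun x i => by
    rw [hWdef, smul_mulVec]; rfl
  have hsum : ∀ (x : Fin n → ℝ) i,
      ∑ j, W i j * (x i - x j) = c * dA i * x i - c * ∑ j, A i j * x j := fun x i => by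
    simp only [hWdef, Matrix.smul_apply, smul_eq_mul, mul_sub, Finset.sum_sub_distrib, hdA,
      Finset.mul_sum, Finset.sum_mul, mul_assoc]
  have hJx : ∀ x i, (J *ᵥ x) i = ∑ j, W i j * (x i - x j) + a i * x i := fun x i => by
    rw [hsum, hJ]
    simp only [add_mulVec, sub_mulVec, smul_mulVec, mulVec_diagonal, Pi.add_apply, Pi.sub_apply,
      Pi.smul_apply, smul_eq_mul, hadef]
    simp only [mulVec, dotProduct]
    ring
  have hJsymm : J.IsHermitian := by
    rw [IsHermitian, conjTranspose_eq_transpose_of_trivial, hJ]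
    simp [hAsymm.eq]
  have hJpos : J.PosDef := by
    refine posDef_of_mulVec_eq_laplacian_add hJsymm hJx hW hW0 ha fun i => ?_
    obtain ⟨m, w, rfl, hw, hm⟩ := hreach i
    refine ⟨w (Fin.last m), ?_, hm⟩
    induction Fin.last m using Fin.induction with
    | zero => exact .refl
    | succ l ih => exact ih.tail (by simpa [hWdef, hw l] using hc)
  have hPs : Summable fun k : ℕ => P ^ k := by
    set v := J⁻¹ *ᵥ (1 : Fin n → ℝ)
    have hJv : J *ᵥ v = 1 := by
      rw [mulVec_mulVec, mul_nonsing_inv _ (J.isUnit_iff_isUnit_det.1 hJpos.isUnit), one_mulVec]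
    have hv := pos_of_laplacian_add_pos (v := v) hW0 ha fun i => by
      rw [← hJx, hJv]; exact one_pos
    refine summable_pow_of_mulVec_lt (fun i j => ?_) hv fun i => ?_
    · rw [hP, diagonal_mul]
      exact mul_nonneg (inv_nonneg.2 (hpos i).le) (hW0 i j)
    · have h1 := hJx v i
      rw [hJv, Pi.one_apply, hsum] at h1
      rw [hP, ← mulVec_mulVec, mulVec_diagonal, hWx, inv_mul_lt_iff₀ (hpos i)]
      simp only [hadef] at h1
      linarith
  refine ⟨fun μ hμ => norm_lt_one_of_mem_spectrum_of_tendsto_pow ?_ hμ, hPs, hJpos⟩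
  have hcont : Continuous fun R : Matrix (Fin n) (Fin n) ℝ => R.map (algebraMap ℝ ℂ) :=
    continuous_id.matrix_map Complex.continuous_ofReal
  have hmap : ∀ k : ℕ, P.map (algebraMap ℝ ℂ) ^ k = (P ^ k).map (algebraMap ℝ ℂ) := fun k =>
    (map_pow (algebraMap ℝ ℂ).mapMatrix P k).symm
  simp only [hmap]
  simpa [Function.comp_def] using (hcont.tendsto 0).comp hPs.tendsto_atTop_zero
end

section
/- Under the synchronization FIM setup, assume that for every pair (i,j) the series Δ_{ij} := Σ_{k=1}^∞ [P^k]_{ij} converges (so J is invertible). Then for every i, [J^{-1}]_{ii} ≥ 1/(c·(d_A(i)+d_R(i)) + ξ(i)) = 1/[J]_{ii}; that is, the absolute synchronization error bound of each agent is never smaller than the bound it would attain if all its neighbors were reference nodes, with equality if and only if Δ_{ii} = 0. -/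
open Matrix

theorem Matrix.summable_of_apply {ι m n R : Type*} [AddCommMonoid R] [TopologicalSpace R]
    {f : ι → Matrix m n R} (h : ∀ i j, Summable fun k => f k i j) : Summable f :=
  Pi.summable.2 fun i => Pi.summable.2 fun j => h i j

theorem Matrix.tsum_apply_apply {ι m n R : Type*} [AddCommMonoid R] [TopologicalSpace R]
    [T2Space R] {f : ι → Matrix m n R} (h : Summable f) (i : m) (j : n) :
    (∑' k, f k) i j = ∑' k, f k i j :=
  ((Pi.hasSum.1 (Pi.hasSum.1 h.hasSum i) j).tsum_eq).symm

/-- The diagonal of `(D (1 - P))⁻¹` in terms of the Neumann series of `P`. -/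
theorem Matrix.inv_diagonal_mul_one_sub_apply_self {n : Type*} [Fintype n] [DecidableEq n]
    {d : n → ℝ} (hd : ∀ i, d i ≠ 0) {P : Matrix n n ℝ}
    (hP : ∀ i j, Summable fun k : ℕ => (P ^ (k + 1)) i j) (i : n) :
    (diagonal d * (1 - P))⁻¹ i i = (1 + ∑' k : ℕ, (P ^ (k + 1)) i i) * (d i)⁻¹ := by
  have hP' (i j : n) : Summable fun k : ℕ => (P ^ k) i j :=
    (summable_nat_add_iff (f := fun k => (P ^ k) i j) 1).1 (hP i j)
  have hs : Summable fun k : ℕ => P ^ k := summable_of_apply hP'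
  have hdd : diagonal d * diagonal (fun i => (d i)⁻¹) = 1 := by
    simp [diagonal_mul_diagonal, hd]
  have hinv : (diagonal d * (1 - P))⁻¹ = (∑' k : ℕ, P ^ k) * diagonal fun i => (d i)⁻¹ := by
    refine inv_eq_right_inv ?_
    rw [mul_assoc, ← mul_assoc (1 - P), hs.one_sub_mul_tsum_pow, one_mul, hdd]
  rw [hinv, mul_diagonal, tsum_apply_apply hs, (hP' i i).tsum_eq_zero_add, pow_zero, one_apply_eq]

/-- Efficiency of cooperation (Remark 2 of the paper): under the
synchronization FIM setup with all series `Δ_{ij} = Σ_{k≥1} [P^k]_{ij}`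
convergent, each diagonal entry of `J⁻¹` satisfies
`[J⁻¹]_{ii} ≥ 1/(c·(d_A(i)+d_R(i)) + ξ(i)) = 1/[J]_{ii}`,
with equality iff `Δ_{ii} = 0`. -/
theorem cooperation_efficiency {n : ℕ} (hn : 1 ≤ n)
    (A : Matrix (Fin n) (Fin n) ℝ) (hAsymm : A.IsSymm)
    (hA01 : ∀ i j, A i j = 0 ∨ A i j = 1) (hAdiag : ∀ i, A i i = 0)
    (dA : Fin n → ℝ) (hdA : ∀ i, dA i = ∑ j, A i j)
    (dR : Fin n → ℕ) (ξ : Fin n → ℝ) (hξ : ∀ i, 0 ≤ ξ i)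
    (c : ℝ) (hc : 0 < c)
    (hpos : ∀ i, 0 < c * (dA i + dR i) + ξ i)
    (P : Matrix (Fin n) (Fin n) ℝ)
    (hP : P = Matrix.diagonal (fun i => (c * (dA i + dR i) + ξ i)⁻¹) * (c • A))
    (J : Matrix (Fin n) (Fin n) ℝ)
    (hJ : J = c • (Matrix.diagonal dA + Matrix.diagonal (fun i => (dR i : ℝ)) - A)
            + Matrix.diagonal ξ)
    (hΔ : ∀ i j, Summable (fun k : ℕ => (P ^ (k + 1)) i j)) :
    ∀ i, J i i = c * (dA i + dR i) + ξ i ∧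
      (c * (dA i + dR i) + ξ i)⁻¹ ≤ J⁻¹ i i ∧
      (J⁻¹ i i = (c * (dA i + dR i) + ξ i)⁻¹ ↔
        ∑' k : ℕ, (P ^ (k + 1)) i i = 0) := by
  intro i
  have hA0 (i j) : 0 ≤ A i j := by rcases hA01 i j with h | h <;> simp [h]
  have hP0 (i j) : 0 ≤ P i j := by
    rw [hP, diagonal_mul, Matrix.smul_apply, smul_eq_mul]
    exact mul_nonneg (inv_nonneg.2 (hpos i).le) (mul_nonneg hc.le (hA0 i j))
  have hJP : J = diagonal (fun i => c * (dA i + dR i) + ξ i) * (1 - P) := by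
    ext i j
    have := (hpos i).ne'
    rw [hP, hJ, diagonal_mul, Matrix.sub_apply, diagonal_mul]
    by_cases hij : i = j
    · subst hij
      simp [hAdiag]
    · simp [hij]
      field_simp
  have hΔ0 : 0 ≤ ∑' k : ℕ, (P ^ (k + 1)) i i :=
    tsum_nonneg fun k => Matrix.pow_apply_nonneg hP0 (k + 1) i i
  have hinv := inv_diagonal_mul_one_sub_apply_self (fun i => (hpos i).ne') hΔ i
  rw [← hJP] at hinv
  have hd := inv_pos.2 (hpos i)
  refine ⟨by simp [hJ, hAdiag], ?_, ?_⟩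
  · rw [hinv]
    exact le_mul_of_one_le_left hd.le (by linarith)
  · rw [hinv, mul_eq_right₀ hd.ne', add_eq_left]
end
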